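/- For every k ∈ (0, k_max), V(k) = max_{θ₂<0} max_{θ₁∈ℝ} (k + K(θ₁,θ₂) − θ₁)/θ₂ = max_{θ₂<0} (k + G(θ₂))/θ₂, and both maxima are attained. -/

import Mathlib

open MeasureTheory Filter Set Topology
open scoped ENNReal

noncomputable section

variable {Ω : Type*} [MeasurableSpace Ω]

/-- The positive part of an extended real number, as a member of `ℝ≥0∞`. -/
def ePos (x : EReal) : ℝ≥0∞ := if x = ⊤ then ⊤ else ENNReal.ofReal x.toReal

/-- The (signed) integral of an extended-real-valued function: the integral of its
positive part minus the integral of its negative part. -/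
def eInt (μ : Measure Ω) (f : Ω → EReal) : EReal :=
  ((∫⁻ r, ePos (f r) ∂μ : ℝ≥0∞) : EReal) - ((∫⁻ r, ePos (-(f r)) ∂μ : ℝ≥0∞) : EReal)

/-- `p` is a probability density with respect to `μ`. -/
def IsDensity (μ : Measure Ω) (p : Ω → ℝ) : Prop :=
  Measurable p ∧ (∀ r, 0 ≤ p r) ∧ ∫⁻ r, ENNReal.ofReal (p r) ∂μ = 1

/-- `∫ p dμ` for a nonnegative function `p`. -/
def pInt (μ : Measure Ω) (p : Ω → ℝ) : ℝ≥0∞ := ∫⁻ r, ENNReal.ofReal (p r) ∂μ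

/-- The convex integral functional `H(p) = ∫ β(r, p(r)) μ(dr)`. -/
def Hfun (μ : Measure Ω) (β : Ω → ℝ → EReal) (p : Ω → ℝ) : EReal :=
  eInt μ (fun r => β r (p r))

/-- The expected payoff `∫ X p dμ`, as an extended real number. -/
def xInt (μ : Measure Ω) (X p : Ω → ℝ) : EReal :=
  eInt μ (fun r => ((X r * p r : ℝ) : EReal))

/-- The value function `F(b) = inf { H(p) : p density, ∫ X p dμ = b }`. -/
def Ffun (μ : Measure Ω) (β : Ω → ℝ → EReal) (X : Ω → ℝ) (b : ℝ) : EReal :=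
  ⨅ p : {p : Ω → ℝ // IsDensity μ p ∧ xInt μ X p = (b : EReal)}, Hfun μ β p.1

/-- The essential infimum `m` of `X`, as an extended real number. -/
def essInfX (μ : Measure Ω) (X : Ω → ℝ) : EReal := essInf (fun r => (X r : EReal)) μ

/-- The essential supremum `M` of `X`, as an extended real number. -/
def essSupX (μ : Measure Ω) (X : Ω → ℝ) : EReal := essSup (fun r => (X r : EReal)) μ

/-- `k_max = lim_{b ↓ m} F(b)`; since `F` is nonincreasing on `(m, b₀)`, this limit
equals the supremum of `F` over `(m, b₀)`. -/
def kmax (μ : Measure Ω) (β : Ω → ℝ → EReal) (X : Ω → ℝ) (b₀ : ℝ) : EReal :=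
  ⨆ b : {b : ℝ // essInfX μ X < (b : EReal) ∧ b < b₀}, Ffun μ β X b

/-- `V(k) = inf { ∫ X p dμ : p density, H(p) ≤ k }`. -/
def Vfun (μ : Measure Ω) (β : Ω → ℝ → EReal) (X : Ω → ℝ) (k : ℝ) : EReal :=
  ⨅ p : {p : Ω → ℝ // IsDensity μ p ∧ Hfun μ β p ≤ (k : EReal)}, xInt μ X p.1

/-- `W(λ) = inf { ∫ X p dμ + λ H(p) : p density }`. -/
def Wfun (μ : Measure Ω) (β : Ω → ℝ → EReal) (X : Ω → ℝ) (lam : ℝ) : EReal :=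
  ⨅ p : {p : Ω → ℝ // IsDensity μ p}, (xInt μ X p.1 + (lam : EReal) * Hfun μ β p.1)

/-- The convex conjugate `β*(r, τ) = sup_s (sτ − β(r,s))` of `β` in its second variable. -/
def conjβ (β : Ω → ℝ → EReal) (r : Ω) (τ : ℝ) : EReal :=
  ⨆ s : ℝ, (((s * τ : ℝ) : EReal) - β r s)

/-- `K(θ₁, θ₂) = ∫ β*(r, θ₁ + θ₂ X(r)) μ(dr)`. -/
def Kfun (μ : Measure Ω) (β : Ω → ℝ → EReal) (X : Ω → ℝ) (θ₁ θ₂ : ℝ) : EReal :=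
  eInt μ (fun r => conjβ β r (θ₁ + θ₂ * X r))

/-- `dom K = {(θ₁, θ₂) : K(θ₁,θ₂) < +∞}`. -/
def domK (μ : Measure Ω) (β : Ω → ℝ → EReal) (X : Ω → ℝ) : Set (ℝ × ℝ) :=
  {θ : ℝ × ℝ | Kfun μ β X θ.1 θ.2 < ⊤}

/-- `β'(r, +∞) = lim_{s ↑ ∞} β'(r,s)`; by monotonicity of the derivative of a convex
function this equals the supremum of `β'(r, ·)` over `(0, ∞)`. -/
def derivTop (β' : Ω → ℝ → ℝ) (r : Ω) : EReal := ⨆ s : {s : ℝ // 0 < s}, (β' r s.1 : EReal)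

/-- `β'(r, 0) = lim_{s ↓ 0} β'(r,s)`, the infimum of `β'(r, ·)` over `(0, ∞)`. -/
def derivZero (β' : Ω → ℝ → ℝ) (r : Ω) : EReal := ⨅ s : {s : ℝ // 0 < s}, (β' r s.1 : EReal)

/-- The parameter set `Θ`. -/
def ThetaSet (μ : Measure Ω) (β : Ω → ℝ → EReal) (β' : Ω → ℝ → ℝ) (X : Ω → ℝ) :
    Set (ℝ × ℝ) :=
  {θ ∈ domK μ β X | ∀ᵐ r ∂μ, ((θ.1 + θ.2 * X r : ℝ) : EReal) < derivTop β' r}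

/-- The generalised exponential family member `p_{θ₁,θ₂}(r) = (β*)'(r, θ₁ + θ₂ X(r))`,
where `ψ` denotes the derivative `(β*)'` of the conjugate in its second variable. -/
def pFam (ψ : Ω → ℝ → ℝ) (X : Ω → ℝ) (θ₁ θ₂ : ℝ) : Ω → ℝ :=
  fun r => ψ r (θ₁ + θ₂ * X r)

/-- `G(θ₂) = inf_{θ₁} [K(θ₁,θ₂) − θ₁]`. -/
def Gfun (μ : Measure Ω) (β : Ω → ℝ → EReal) (X : Ω → ℝ) (θ₂ : ℝ) : EReal :=
  ⨅ θ₁ : ℝ, (Kfun μ β X θ₁ θ₂ - (θ₁ : EReal))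

/-- `Θ₂ = dom G`, the projection of `dom K` to the `θ₂`-axis. -/
def Theta2 (μ : Measure Ω) (β : Ω → ℝ → EReal) (X : Ω → ℝ) : Set ℝ :=
  {θ₂ : ℝ | Gfun μ β X θ₂ < ⊤}

/-- The Bregman integrand `Δ_β(r, s, t)`; for `t = 0` it is defined as the limit `t ↓ 0`
(with `β'(r,0) = lim_{t↓0} β'(r,t)`), and if `β(r,0) = +∞` then `Δ_β(r,0,0) = 0` and
`Δ_β(r,s,0) = +∞` for `s > 0`. -/
def bregmanInt (β : Ω → ℝ → EReal) (β' : Ω → ℝ → ℝ) (r : Ω) (s t : ℝ) : EReal :=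
  if 0 < t then β r s - β r t - ((β' r t : EReal) * ((s - t : ℝ) : EReal))
  else if β r 0 = ⊤ then (if s = 0 then 0 else ⊤)
  else β r s - β r 0 - derivZero β' r * ((s : ℝ) : EReal)

/-- The (generalised) Bregman distance `B(p, q)`. -/
def Bdist (μ : Measure Ω) (β : Ω → ℝ → EReal) (β' : Ω → ℝ → ℝ) (p q : Ω → ℝ) : EReal :=
  eInt μ (fun r => bregmanInt β β' r (p r) (q r))

/-- The standing assumptions of the framework: `μ` is σ-finite; `β` is a normal convex
integrand (measurable in `r`; equal to `+∞` for `s < 0`; finite, strictly convex and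
differentiable with derivative `β'` on `(0,∞)`; right-continuous at `0`); `p₀` is a
density with finite expected payoff `b₀` satisfying `m < b₀ < M`; `H(p₀) = 0 ≤ H(p)`
for every density `p`; and `k_max > 0`. -/
structure Standing (μ : Measure Ω) (β : Ω → ℝ → EReal) (β' : Ω → ℝ → ℝ)
    (X : Ω → ℝ) (p₀ : Ω → ℝ) (b₀ : ℝ) : Prop where
  sigma : SigmaFinite μ
  betaMeas : ∀ s : ℝ, Measurable (fun r => β r s)
  Xmeas : Measurable X
  betaNeg : ∀ r : Ω, ∀ s : ℝ, s < 0 → β r s = ⊤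
  betaNeBot : ∀ r s, β r s ≠ ⊥
  betaFin : ∀ r : Ω, ∀ s : ℝ, 0 < s → β r s ≠ ⊤
  betaZero : ∀ r, Tendsto (fun s => β r s) (𝓝[>] (0:ℝ)) (𝓝 (β r 0))
  betaConv : ∀ r, StrictConvexOn ℝ (Ioi (0:ℝ)) (fun s => (β r s).toReal)
  betaDeriv : ∀ r : Ω, ∀ s ∈ Ioi (0:ℝ), HasDerivAt (fun t => (β r t).toReal) (β' r s) s
  dens₀ : IsDensity μ p₀
  payoff₀ : xInt μ X p₀ = (b₀ : EReal)
  mlt : essInfX μ X < (b₀ : EReal)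
  ltM : (b₀ : EReal) < essSupX μ X
  H₀ : Hfun μ β p₀ = 0
  Hnonneg : ∀ p, IsDensity μ p → 0 ≤ Hfun μ β p
  kmaxPos : 0 < kmax μ β X b₀

/-- The hypothesis that `ψ = (β*)'`: at every point `τ < β'(r,+∞)`, where the conjugate
`β*(r,·)` is finite and differentiable, `ψ r τ` is its derivative. -/
def IsConjDeriv (β : Ω → ℝ → EReal) (β' : Ω → ℝ → ℝ) (ψ : Ω → ℝ → ℝ) : Prop :=
  ∀ r : Ω, ∀ τ : ℝ, ((τ : ℝ) : EReal) < derivTop β' r →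
    HasDerivAt (fun t => (conjβ β r t).toReal) (ψ r τ) τ

/-- `(θ₁, θ₂)` with `θ₂ < 0` attains the double maximum
`max_{θ₂<0} max_{θ₁} (k + K(θ₁,θ₂) − θ₁)/θ₂` (whose value is `V(k)`); such a pair is a
parameter pair of the worst case localiser `q̂_k = p_{θ₁,θ₂}`. -/
def IsWCLParam (μ : Measure Ω) (β : Ω → ℝ → EReal) (X : Ω → ℝ) (k : ℝ) (θ₁ θ₂ : ℝ) : Prop :=
  θ₂ < 0 ∧ ∀ θ₁' θ₂' : ℝ, θ₂' < 0 →
    ((k : EReal) + Kfun μ β X θ₁' θ₂' - (θ₁' : EReal)) / ((θ₂' : ℝ) : EReal) ≤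
      ((k : EReal) + Kfun μ β X θ₁ θ₂ - (θ₁ : EReal)) / ((θ₂ : ℝ) : EReal)

/-- `p` is an (ε-γ)-almost worst case density for threshold `k`. -/
def AWCD (μ : Measure Ω) (β : Ω → ℝ → EReal) (X : Ω → ℝ) (k ε γ : ℝ) (p : Ω → ℝ) : Prop :=
  IsDensity μ p ∧ Hfun μ β p ≤ ((k + γ : ℝ) : EReal) ∧
    xInt μ X p ≤ Vfun μ β X k + (ε : EReal)

/-- Convergence locally in measure. -/
def TendstoLocallyInMeasure (μ : Measure Ω) (p : ℕ → Ω → ℝ) (q : Ω → ℝ) : Prop :=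
  ∀ C : Set Ω, MeasurableSet C → μ C < ⊤ → ∀ ε : ℝ, 0 < ε →
    Tendsto (fun n => μ {r ∈ C | ε < |p n r - q r|}) atTop (𝓝 0)

end

section ExtendedIntegral

variable {Ω : Type*} [MeasurableSpace Ω] {μ : Measure Ω}

lemma measurable_ePos {f : Ω → EReal} (hf : Measurable f) : Measurable fun r => ePos (f r) :=
  measurable_ereal_toENNReal.comp hf

lemma ePos_coe (x : ℝ) : ePos (x : EReal) = ENNReal.ofReal x := rfl

lemma ePos_mono {x y : EReal} (h : x ≤ y) : ePos x ≤ ePos y :=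
  EReal.toENNReal_le_toENNReal h

lemma eInt_of_integrable {f : Ω → EReal} {w : Ω → ℝ} (hw : Integrable w μ)
    (h : ∀ᵐ r ∂μ, f r = (w r : EReal)) : eInt μ f = ((∫ r, w r ∂μ : ℝ) : EReal) := by
  have h1 : ∫⁻ r, ePos (f r) ∂μ = ∫⁻ r, ENNReal.ofReal (w r) ∂μ :=
    lintegral_congr_ae (h.mono fun r hr => by simp only [hr, ePos_coe])
  have h2 : ∫⁻ r, ePos (-(f r)) ∂μ = ∫⁻ r, ENNReal.ofReal (-w r) ∂μ :=
    lintegral_congr_ae (h.mono fun r hr => by simp only [hr, ← EReal.coe_neg, ePos_coe])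
  have h3 : ∫⁻ r, ENNReal.ofReal (w r) ∂μ ≠ ⊤ := hw.lintegral_lt_top.ne
  have h4 : ∫⁻ r, ENNReal.ofReal (-w r) ∂μ ≠ ⊤ := hw.neg.lintegral_lt_top.ne
  rw [eInt, h1, h2, integral_eq_lintegral_pos_part_sub_lintegral_neg_part hw, EReal.coe_sub,
    EReal.coe_ennreal_toReal h3, EReal.coe_ennreal_toReal h4]

lemma integrable_toReal_of_ePos {f : Ω → EReal} (hf : Measurable f)
    (hp : ∫⁻ r, ePos (f r) ∂μ ≠ ⊤) (hn : ∫⁻ r, ePos (-(f r)) ∂μ ≠ ⊤) :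
    (∀ᵐ r ∂μ, f r = ((f r).toReal : EReal)) ∧ Integrable (fun r => (f r).toReal) μ := by
  have h1 : ∀ᵐ r ∂μ, f r = ((f r).toReal : EReal) := by
    filter_upwards [ae_lt_top (measurable_ePos hf) hp, ae_lt_top (measurable_ePos hf.neg) hn]
      with r hr1 hr2
    refine (EReal.coe_toReal (fun h => ?_) (fun h => ?_)).symm
    · rw [h] at hr1; exact hr1.ne (by simp [ePos])
    · simp only [Pi.neg_apply] at hr2
      rw [h] at hr2; exact hr2.ne (by simp [ePos])
  refine ⟨h1, ⟨hf.ereal_toReal.aestronglyMeasurable, ?_⟩⟩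
  rw [hasFiniteIntegral_iff_norm]
  calc ∫⁻ r, ENNReal.ofReal ‖(f r).toReal‖ ∂μ ≤ ∫⁻ r, (ePos (f r) + ePos (-(f r))) ∂μ := by
        refine lintegral_mono_ae (h1.mono fun r hr => ?_)
        rw [hr, ← EReal.coe_neg, ePos_coe, ePos_coe, EReal.toReal_coe, Real.norm_eq_abs]
        rcases abs_cases (f r).toReal with h | h
        · rw [h.1]; exact le_self_add
        · rw [h.1]; exact le_add_self
    _ = _ := lintegral_add_left (measurable_ePos hf) _
    _ < ⊤ := ENNReal.add_lt_top.2 ⟨hp.lt_top, hn.lt_top⟩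

lemma ePos_neg_ne_top_of_eInt_ne_bot {f : Ω → EReal} (h : eInt μ f ≠ ⊥) :
    ∫⁻ r, ePos (-(f r)) ∂μ ≠ ⊤ := by
  intro h1
  apply h
  rw [eInt, h1, EReal.coe_ennreal_top, sub_eq_add_neg, EReal.neg_top, EReal.add_bot]

lemma eInt_eq_top {f : Ω → EReal} (hp : ∫⁻ r, ePos (f r) ∂μ = ⊤)
    (hn : ∫⁻ r, ePos (-(f r)) ∂μ ≠ ⊤) : eInt μ f = ⊤ := by
  rw [eInt, hp, ← EReal.coe_ennreal_toReal hn, EReal.coe_ennreal_top, EReal.top_sub_coe]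

lemma integrable_toReal_of_eInt {f : Ω → EReal} (hf : Measurable f)
    (hb : eInt μ f ≠ ⊥) (ht : eInt μ f ≠ ⊤) :
    (∀ᵐ r ∂μ, f r = ((f r).toReal : EReal)) ∧ Integrable (fun r => (f r).toReal) μ := by
  have hn := ePos_neg_ne_top_of_eInt_ne_bot hb
  exact integrable_toReal_of_ePos hf (fun hp => ht (eInt_eq_top hp hn)) hn

lemma integrable_of_xInt {X p : Ω → ℝ} (hX : Measurable X) (hp : Measurable p)
    (hb : xInt μ X p ≠ ⊥) (ht : xInt μ X p ≠ ⊤) : Integrable (fun r => X r * p r) μ := by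
  simpa only [EReal.toReal_coe, Pi.mul_apply] using
    (integrable_toReal_of_eInt (hX.mul hp).coe_real_ereal hb ht).2

lemma xInt_of_integrable {X p : Ω → ℝ} (h : Integrable (fun r => X r * p r) μ) :
    xInt μ X p = ((∫ r, X r * p r ∂μ : ℝ) : EReal) :=
  eInt_of_integrable h (ae_of_all _ fun _ => rfl)

lemma IsDensity.integrable {p : Ω → ℝ} (hp : IsDensity μ p) : Integrable p μ := by
  refine ⟨hp.1.aestronglyMeasurable, ?_⟩
  rw [hasFiniteIntegral_iff_ofReal (ae_of_all _ hp.2.1), hp.2.2]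
  exact ENNReal.one_lt_top

lemma IsDensity.integral_eq_one {p : Ω → ℝ} (hp : IsDensity μ p) : ∫ r, p r ∂μ = 1 := by
  rw [integral_eq_lintegral_of_nonneg_ae (ae_of_all _ hp.2.1) hp.1.aestronglyMeasurable, hp.2.2]
  rfl

lemma isDensity_of_integral_eq_one {p : Ω → ℝ} (hm : Measurable p) (h0 : ∀ r, 0 ≤ p r)
    (hi : Integrable p μ) (h1 : ∫ r, p r ∂μ = 1) : IsDensity μ p := by
  refine ⟨hm, h0, ?_⟩
  rw [← ofReal_integral_eq_lintegral_ofReal hi (ae_of_all _ h0), h1, ENNReal.ofReal_one]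

end ExtendedIntegral

lemma le_conjβ {Ω : Type*} (β : Ω → ℝ → EReal) (r : Ω) (τ s : ℝ) :
    ((s * τ : ℝ) : EReal) - β r s ≤ conjβ β r τ :=
  le_iSup (fun s : ℝ => ((s * τ : ℝ) : EReal) - β r s) s

section ConvexIntegrand

variable {Ω : Type*} [MeasurableSpace Ω] {μ : Measure Ω} {β : Ω → ℝ → EReal}
  {β' : Ω → ℝ → ℝ} {X p₀ : Ω → ℝ} {b₀ : ℝ}

lemma Standing.coe_toReal_beta (hst : Standing μ β β' X p₀ b₀) (r : Ω) {s : ℝ} (hs : 0 < s) :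
    ((β r s).toReal : EReal) = β r s :=
  EReal.coe_toReal (hst.betaFin r s hs) (hst.betaNeBot r s)

lemma Standing.tendsto_beta_right (hst : Standing μ β β' X p₀ b₀) (r : Ω) {s : ℝ} (hs : 0 ≤ s) :
    Tendsto (β r) (𝓝[>] s) (𝓝 (β r s)) := by
  rcases hs.eq_or_lt with rfl | hs
  · exact hst.betaZero r
  · have h1 : Tendsto (fun t => ((β r t).toReal : EReal)) (𝓝 s) (𝓝 ((β r s).toReal : EReal)) :=
      (continuous_coe_real_ereal.tendsto _).comp (hst.betaDeriv r s hs).continuousAt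
    rw [hst.coe_toReal_beta r hs] at h1
    refine (h1.congr' ?_).mono_left nhdsWithin_le_nhds
    filter_upwards [Ioi_mem_nhds hs] with t ht
    exact hst.coe_toReal_beta r ht

lemma Standing.measurable_beta_comp (hst : Standing μ β β' X p₀ b₀) {p : Ω → ℝ}
    (hp : Measurable p) (h0 : ∀ r, 0 ≤ p r) : Measurable fun r => β r (p r) := by
  let a : ℕ → Ω → ℝ := fun n r => ((⌊(n + 1 : ℝ) * p r⌋₊ : ℝ) + 1) / (n + 1)
  have ha_gt : ∀ n r, p r < a n r := fun n r => by
    rw [lt_div_iff₀ (by positivity), mul_comm]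
    exact Nat.lt_floor_add_one _
  have ha_le : ∀ n r, a n r ≤ p r + 1 / ((n : ℝ) + 1) := fun n r => by
    have hn : (0 : ℝ) < n + 1 := by positivity
    have h1 := Nat.floor_le (mul_nonneg hn.le (h0 r))
    have h2 : (p r + 1 / ((n : ℝ) + 1)) * (n + 1) = (n + 1) * p r + 1 := by field_simp
    rw [div_le_iff₀ hn, h2]
    linarith
  have ha_meas : ∀ n, Measurable fun r => β r (a n r) := fun n => by
    have h1 : Measurable fun z : Ω × ℕ => β z.1 (((z.2 : ℝ) + 1) / (n + 1)) :=
      measurable_from_prod_countable_left fun j =>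
        hst.betaMeas (((j : ℝ) + 1) / (n + 1))
    exact h1.comp (measurable_id.prodMk (Nat.measurable_floor.comp (hp.const_mul _)))
  refine measurable_of_tendsto_metrizable ha_meas (tendsto_pi_nhds.2 fun r => ?_)
  refine (hst.tendsto_beta_right r (h0 r)).comp (tendsto_nhdsWithin_iff.2 ⟨?_, ?_⟩)
  · refine tendsto_of_tendsto_of_tendsto_of_le_of_le tendsto_const_nhds ?_
      (fun n => (ha_gt n r).le) (fun n => ha_le n r)
    simpa using tendsto_const_nhds.add (tendsto_one_div_add_atTop_nhds_zero_nat (𝕜 := ℝ))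
  · exact Eventually.of_forall fun n => ha_gt n r

lemma Standing.conj_le (hst : Standing μ β β' X p₀ b₀) (r : Ω) (τ : ℝ) {c : EReal}
    (hc : ∀ q : ℚ, 0 < q → ((q * τ : ℝ) : EReal) - β r q ≤ c) : conjβ β r τ ≤ c := by
  refine iSup_le fun s => ?_
  rcases lt_or_ge s 0 with hs | hs
  · rw [hst.betaNeg r s hs]
    exact bot_le
  by_contra! hlt
  have h1 : Tendsto (fun t : ℝ => ((t * τ : ℝ) : EReal) - β r t) (𝓝[>] s)
      (𝓝 (((s * τ : ℝ) : EReal) - β r s)) := by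
    have h2 : Tendsto (fun t : ℝ => ((t * τ : ℝ) : EReal)) (𝓝[>] s) (𝓝 ((s * τ : ℝ) : EReal)) :=
      ((continuous_coe_real_ereal.comp (continuous_id.mul continuous_const)).tendsto s).mono_left
        nhdsWithin_le_nhds
    have h3 : Tendsto (fun t : ℝ => -β r t) (𝓝[>] s) (𝓝 (-β r s)) :=
      (continuous_neg.tendsto _).comp (hst.tendsto_beta_right r hs)
    simp only [sub_eq_add_neg]
    exact (EReal.continuousAt_add (p := (((s * τ : ℝ) : EReal), -β r s))
      (Or.inl (EReal.coe_ne_top _)) (Or.inl (EReal.coe_ne_bot _))).tendsto.comp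
      (h2.prodMk_nhds h3)
  obtain ⟨u, hu, hsub⟩ := mem_nhdsGT_iff_exists_Ioo_subset.1 (h1.eventually_const_lt hlt)
  obtain ⟨q, hq1, hq2⟩ := exists_rat_btwn (show s < u from hu)
  exact absurd (hsub ⟨hq1, hq2⟩) (not_lt.2 (hc q (by exact_mod_cast hs.trans_lt hq1)))

lemma Standing.conj_eq_iSup_rat (hst : Standing μ β β' X p₀ b₀) (r : Ω) (τ : ℝ) :
    conjβ β r τ = ⨆ q : {q : ℚ // 0 < q}, (((q.1 * τ : ℝ) : EReal) - β r q.1) :=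
  le_antisymm (hst.conj_le r τ fun q hq =>
      le_iSup (fun q : {q : ℚ // 0 < q} => (((q.1 * τ : ℝ) : EReal) - β r q.1)) ⟨q, hq⟩)
    (iSup_le fun q => le_conjβ β r τ q.1)

lemma Standing.measurable_conj (hst : Standing μ β β' X p₀ b₀) {τ : Ω → ℝ} (hτ : Measurable τ) :
    Measurable fun r => conjβ β r (τ r) := by
  simp only [hst.conj_eq_iSup_rat]
  refine Measurable.iSup fun q => ?_
  exact (hτ.const_mul _).coe_real_ereal.sub (hst.betaMeas _)

end ConvexIntegrand

/-- A nonnegative function `p` with finite mass and payoff, together with an integrable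
majorant `g` of `r ↦ β r (p r)`. Using majorants keeps this class of pairs convex without any
lower bound on `β r (p r)`. -/
structure Majorized {Ω : Type*} [MeasurableSpace Ω] (μ : Measure Ω) (β : Ω → ℝ → EReal)
    (X p g : Ω → ℝ) : Prop where
  meas : Measurable p
  nonneg : ∀ r, 0 ≤ p r
  integrable : Integrable p μ
  integrable_payoff : Integrable (fun r => X r * p r) μ
  integrable_majorant : Integrable g μ
  le_majorant : ∀ᵐ r ∂μ, β r (p r) ≤ (g r : EReal)

section Majorized

variable {Ω : Type*} [MeasurableSpace Ω] {μ : Measure Ω} {β : Ω → ℝ → EReal}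
  {β' : Ω → ℝ → ℝ} {X p₀ p g q h : Ω → ℝ} {b₀ : ℝ}

lemma Majorized.isDensity (hp : Majorized μ β X p g) (h1 : ∫ r, p r ∂μ = 1) : IsDensity μ p :=
  isDensity_of_integral_eq_one hp.meas hp.nonneg hp.integrable h1

lemma Majorized.Hfun_le (hp : Majorized μ β X p g) :
    Hfun μ β p ≤ ((∫ r, g r ∂μ : ℝ) : EReal) := by
  rw [← eInt_of_integrable hp.integrable_majorant (ae_of_all _ fun _ => rfl)]
  refine EReal.sub_le_sub ?_ ?_
  · exact EReal.coe_ennreal_le_coe_ennreal_iff.2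
      (lintegral_mono_ae (hp.le_majorant.mono fun r hr => ePos_mono hr))
  · exact EReal.coe_ennreal_le_coe_ennreal_iff.2
      (lintegral_mono_ae (hp.le_majorant.mono fun r hr => ePos_mono (EReal.neg_le_neg_iff.2 hr)))

lemma Majorized.add_majorant (hp : Majorized μ β X p g) (hi : Integrable h μ)
    (h0 : ∀ r, 0 ≤ h r) : Majorized μ β X p (fun r => g r + h r) where
  __ := hp
  integrable_majorant := hp.integrable_majorant.add hi
  le_majorant := hp.le_majorant.mono fun r hr =>
    hr.trans (EReal.coe_le_coe_iff.2 (le_add_of_nonneg_right (h0 r)))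

lemma Standing.beta_convex_le (hst : Standing μ β β' X p₀ b₀) (r : Ω) {s u a b t : ℝ}
    (hs : 0 ≤ s) (hu : 0 ≤ u) (ht0 : 0 ≤ t) (ht1 : t ≤ 1)
    (hsa : β r s ≤ (a : EReal)) (hub : β r u ≤ (b : EReal)) :
    β r ((1 - t) * s + t * u) ≤ (((1 - t) * a + t * b : ℝ) : EReal) := by
  set z := (1 - t) * s + t * u with hz
  have hz0 : 0 ≤ z := by have := sub_nonneg.2 ht1; positivity
  have hshift : ∀ {x : ℝ}, 0 ≤ x →
      Tendsto (fun e : ℝ => β r (x + e)) (𝓝[>] 0) (𝓝 (β r x)) := fun {x} hx => by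
    refine (hst.tendsto_beta_right r hx).comp (tendsto_nhdsWithin_iff.2 ⟨?_, ?_⟩)
    · have : Tendsto (fun e : ℝ => x + e) (𝓝 0) (𝓝 (x + 0)) :=
        tendsto_const_nhds.add tendsto_id
      rw [add_zero] at this
      exact this.mono_left nhdsWithin_le_nhds
    · filter_upwards [self_mem_nhdsWithin] with e he
      exact lt_add_of_pos_right x he
  have key : ∀ δ : ℝ, 0 < δ → β r z ≤ (((1 - t) * a + t * b + δ : ℝ) : EReal) := fun δ hδ => by
    refine le_of_tendsto (hshift hz0) ?_
    have ha : β r s < ((a + δ : ℝ) : EReal) :=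
      hsa.trans_lt (EReal.coe_lt_coe_iff.2 (lt_add_of_pos_right a hδ))
    have hb : β r u < ((b + δ : ℝ) : EReal) :=
      hub.trans_lt (EReal.coe_lt_coe_iff.2 (lt_add_of_pos_right b hδ))
    filter_upwards [(hshift hs).eventually_lt_const ha, (hshift hu).eventually_lt_const hb,
      self_mem_nhdsWithin] with e he1 he2 he
    have he : 0 < e := he
    have h1 := (hst.betaConv r).convexOn.2 (show s + e ∈ Ioi (0:ℝ) from by simp; positivity)
      (show u + e ∈ Ioi (0:ℝ) from by simp; positivity) (sub_nonneg.2 ht1) ht0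
      (sub_add_cancel 1 t)
    simp only [smul_eq_mul] at h1
    rw [show (1 - t) * (s + e) + t * (u + e) = z + e by rw [hz]; ring] at h1
    rw [← hst.coe_toReal_beta r (by positivity), EReal.coe_lt_coe_iff] at he1 he2
    rw [← hst.coe_toReal_beta r (by positivity), EReal.coe_le_coe_iff]
    nlinarith [mul_le_mul_of_nonneg_left he1.le (sub_nonneg.2 ht1),
      mul_le_mul_of_nonneg_left he2.le ht0]
  by_contra! hlt
  obtain ⟨x, hx1, hx2⟩ := EReal.lt_iff_exists_real_btwn.1 hlt
  have h1 := key (x - ((1 - t) * a + t * b)) (sub_pos.2 (EReal.coe_lt_coe_iff.1 hx1))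
  rw [add_sub_cancel] at h1
  exact absurd hx2 (not_lt.2 h1)

lemma Majorized.convex_comb (hst : Standing μ β β' X p₀ b₀) (hp : Majorized μ β X p g)
    (hq : Majorized μ β X q h) {t : ℝ} (ht0 : 0 ≤ t) (ht1 : t ≤ 1) :
    Majorized μ β X (fun r => (1 - t) * p r + t * q r) (fun r => (1 - t) * g r + t * h r) where
  meas := (hp.meas.const_mul _).add (hq.meas.const_mul _)
  nonneg r := add_nonneg (mul_nonneg (sub_nonneg.2 ht1) (hp.nonneg r)) (mul_nonneg ht0 (hq.nonneg r))
  integrable := (hp.integrable.const_mul _).add (hq.integrable.const_mul _)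
  integrable_payoff := by
    refine ((hp.integrable_payoff.const_mul (1 - t)).add
      (hq.integrable_payoff.const_mul t)).congr (ae_of_all _ fun r => ?_)
    simp only [Pi.add_apply]; ring
  integrable_majorant :=
    (hp.integrable_majorant.const_mul _).add (hq.integrable_majorant.const_mul _)
  le_majorant := by
    filter_upwards [hp.le_majorant, hq.le_majorant] with r h1 h2
    exact hst.beta_convex_le r (hp.nonneg r) (hq.nonneg r) ht0 ht1 h1 h2

lemma integral_convex_comb {f f' : Ω → ℝ} (hf : Integrable f μ) (hf' : Integrable f' μ) (t : ℝ) :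
    ∫ r, ((1 - t) * f r + t * f' r) ∂μ = (1 - t) * ∫ r, f r ∂μ + t * ∫ r, f' r ∂μ := by
  rw [integral_add (hf.const_mul _) (hf'.const_mul _), integral_const_mul, integral_const_mul]

lemma Majorized.integral_payoff_convex_comb (hp : Majorized μ β X p g)
    (hq : Majorized μ β X q h) (t : ℝ) :
    ∫ r, X r * ((1 - t) * p r + t * q r) ∂μ =
      (1 - t) * ∫ r, X r * p r ∂μ + t * ∫ r, X r * q r ∂μ := by
  rw [← integral_convex_comb hp.integrable_payoff hq.integrable_payoff]
  congr with r
  ring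

lemma IsDensity.majorized (hst : Standing μ β β' X p₀ b₀) (hp : IsDensity μ p)
    (hX : Integrable (fun r => X r * p r) μ) (hH : Hfun μ β p ≠ ⊤) :
    Majorized μ β X p (fun r => (β r (p r)).toReal) ∧
      Hfun μ β p = ((∫ r, (β r (p r)).toReal ∂μ : ℝ) : EReal) := by
  have hb : Hfun μ β p ≠ ⊥ := fun h => by
    have := hst.Hnonneg p hp
    simp [h] at this
  obtain ⟨h1, h2⟩ := integrable_toReal_of_eInt (hst.measurable_beta_comp hp.1 hp.2.1) hb hH
  exact ⟨⟨hp.1, hp.2.1, hp.integrable, hX, h2, h1.mono fun r hr => hr.le⟩,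
    eInt_of_integrable h2 h1⟩

lemma Standing.integrable_payoff (hst : Standing μ β β' X p₀ b₀) :
    Integrable (fun r => X r * p₀ r) μ :=
  integrable_of_xInt hst.Xmeas hst.dens₀.1 (by simp [hst.payoff₀]) (by simp [hst.payoff₀])

lemma Standing.integral_payoff (hst : Standing μ β β' X p₀ b₀) : ∫ r, X r * p₀ r ∂μ = b₀ := by
  have h1 := xInt_of_integrable hst.integrable_payoff
  rw [hst.payoff₀] at h1
  exact_mod_cast h1.symm

lemma Standing.majorized (hst : Standing μ β β' X p₀ b₀) :
    Majorized μ β X p₀ (fun r => (β r (p₀ r)).toReal) :=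
  (hst.dens₀.majorized hst hst.integrable_payoff (by simp [hst.H₀])).1

lemma Standing.integral_beta (hst : Standing μ β β' X p₀ b₀) :
    ∫ r, (β r (p₀ r)).toReal ∂μ = 0 := by
  have h1 := (hst.dens₀.majorized hst hst.integrable_payoff (by simp [hst.H₀])).2
  rw [hst.H₀] at h1
  exact_mod_cast h1.symm

open Classical in
/-- Any positive measurable function `s` can replace `p` on large sets. -/
lemma Majorized.exists_replace (hst : Standing μ β β' X p₀ b₀) (hp : Majorized μ β X p g)
    {s : Ω → ℝ} (hs : Measurable s) (hs0 : ∀ r, 0 < s r) :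
    ∃ E : ℕ → Set Ω, (∀ n, MeasurableSet (E n)) ∧ Monotone E ∧ ⋃ n, E n = univ ∧
      ∀ n, ∀ D, MeasurableSet D → D ⊆ E n → Majorized μ β X (D.piecewise s p)
        (D.piecewise (fun r => (β r (s r)).toReal) g) := by
  have := hst.sigma
  have hβ : Measurable fun r => (β r (s r)).toReal :=
    (hst.measurable_beta_comp hs fun r => (hs0 r).le).ereal_toReal
  let c : Ω → ℝ := fun r => max (|s r|) (max (|X r * s r|) (|(β r (s r)).toReal|))
  have hc : Measurable c := by
    have h1 := hst.Xmeas
    fun_prop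
  let E : ℕ → Set Ω := fun n => spanningSets μ n ∩ {r | c r ≤ n}
  have hE : ∀ n, MeasurableSet (E n) := fun n =>
    (measurableSet_spanningSets μ n).inter (measurableSet_le hc measurable_const)
  have hE_mono : Monotone E := fun i j hij =>
    inter_subset_inter (monotone_spanningSets μ hij)
      fun r (hr : c r ≤ i) => hr.trans (by exact_mod_cast hij)
  refine ⟨E, hE, hE_mono, ?_, fun n D hD hDE => ?_⟩
  · refine eq_univ_of_forall fun r => ?_
    have h1 : r ∈ ⋃ n, spanningSets μ n := by rw [iUnion_spanningSets]; trivial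
    obtain ⟨i, hi⟩ := mem_iUnion.1 h1
    obtain ⟨j, hj⟩ := exists_nat_ge (c r)
    exact mem_iUnion.2 ⟨max i j, monotone_spanningSets μ (le_max_left i j) hi,
      hj.trans (by exact_mod_cast le_max_right i j)⟩
  have hfin : μ D ≠ ⊤ :=
    ((measure_mono (hDE.trans inter_subset_left)).trans_lt
      (measure_spanningSets_lt_top μ n)).ne
  have hint : ∀ {f : Ω → ℝ}, Measurable f → (∀ r, |f r| ≤ c r) → IntegrableOn f D μ :=
    fun {f} hf hfc => Measure.integrableOn_of_bounded (M := n) hfin hf.aestronglyMeasurable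
      ((ae_restrict_iff' hD).2 (ae_of_all _ fun r hr => (hfc r).trans (hDE hr).2))
  refine ⟨hs.piecewise hD hp.meas, fun r => ?_, ?_, ?_, ?_, ?_⟩
  · by_cases hr : r ∈ D
    · simpa [hr] using (hs0 r).le
    · simpa [hr] using hp.nonneg r
  · exact Integrable.piecewise hD (hint hs fun r => le_max_left _ _) hp.integrable.integrableOn
  · have h1 := Integrable.piecewise hD (hint (hst.Xmeas.mul hs) fun r =>
      (le_max_left _ _).trans (le_max_right _ _)) hp.integrable_payoff.integrableOn
    refine h1.congr (ae_of_all _ fun r => ?_)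
    by_cases hr : r ∈ D
    · simp [Set.piecewise, hr]
    · simp [Set.piecewise, hr]
  · exact Integrable.piecewise hD (hint hβ fun r => (le_max_right _ _).trans (le_max_right _ _))
      hp.integrable_majorant.integrableOn
  · filter_upwards [hp.le_majorant] with r hle
    by_cases hr : r ∈ D
    · simp [Set.piecewise, hr, hst.coe_toReal_beta r (hs0 r)]
    · simpa [Set.piecewise, hr] using hle

end Majorized

section Construction

variable {Ω : Type*} [MeasurableSpace Ω] {μ : Measure Ω} {β : Ω → ℝ → EReal}
  {β' : Ω → ℝ → ℝ} {X p₀ p g : Ω → ℝ} {b₀ : ℝ}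

lemma Standing.exists_small (hst : Standing μ β β' X p₀ b₀) {ε : ℝ} (hε : 0 < ε) :
    ∃ p g, Majorized μ β X p g ∧ ∫ r, p r ∂μ ≤ ε ∧ |∫ r, X r * p r ∂μ| ≤ ε := by
  classical
  have := hst.sigma
  obtain ⟨u, hu0, hum, hul⟩ := exists_pos_lintegral_lt_of_sigmaFinite μ
    (ENNReal.ofReal_pos.2 (half_pos hε)).ne'
  have hu : Integrable (fun r => (u r : ℝ)) μ := by
    refine ⟨hum.coe_nnreal_real.aestronglyMeasurable, ?_⟩
    rw [hasFiniteIntegral_iff_ofReal (ae_of_all _ fun r => (u r).coe_nonneg)]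
    simpa only [ENNReal.ofReal_coe_nnreal] using hul.trans ENNReal.ofReal_lt_top
  have hu_le : ∫ r, (u r : ℝ) ∂μ ≤ ε / 2 := by
    rw [integral_eq_lintegral_of_nonneg_ae (ae_of_all _ fun r => (u r).coe_nonneg) hu.1]
    simp only [ENNReal.ofReal_coe_nnreal]
    exact ENNReal.toReal_le_of_le_ofReal (half_pos hε).le hul.le
  have hX1 : ∀ r, 0 < 1 + |X r| := fun r => by positivity
  let w : Ω → ℝ := fun r => u r / (1 + |X r|)
  have hwm : Measurable w := by
    have := hst.Xmeas
    fun_prop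
  have hw0 : ∀ r, 0 < w r := fun r => div_pos (by exact_mod_cast hu0 r) (hX1 r)
  obtain ⟨E, hE, hmono, hunion, hrep⟩ := hst.majorized.exists_replace hst hwm hw0
  let v : Ω → ℝ := fun r => p₀ r + |X r * p₀ r|
  have hv : Integrable v μ := hst.majorized.integrable.add hst.integrable_payoff.abs
  have hlim : Tendsto (fun n => ∫ r in (E n)ᶜ, v r ∂μ) atTop (𝓝 0) := by
    have h1 := Antitone.tendsto_setIntegral (μ := μ) (s := fun n => (E n)ᶜ) (f := v)
      (fun n => (hE n).compl) (fun i j hij => compl_subset_compl.2 (hmono hij)) hv.integrableOn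
    rwa [← compl_iUnion, hunion, compl_univ, setIntegral_empty] at h1
  obtain ⟨n, hn⟩ := (hlim.eventually_lt_const (half_pos hε)).exists
  have hmaj := hrep n (E n) (hE n) subset_rfl
  have hdom : Integrable (fun r => (u r : ℝ) + (E n)ᶜ.indicator v r) μ :=
    hu.add (hv.indicator (hE n).compl)
  have hdom_le : ∫ r, ((u r : ℝ) + (E n)ᶜ.indicator v r) ∂μ ≤ ε := by
    rw [integral_add hu (hv.indicator (hE n).compl), integral_indicator (hE n).compl]
    linarith
  have hpt : ∀ r, (E n).piecewise w p₀ r + |X r * (E n).piecewise w p₀ r| ≤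
      u r + (E n)ᶜ.indicator v r := fun r => by
    by_cases hr : r ∈ E n
    · have h1 : w r + |X r * w r| = u r := by
        rw [abs_mul, abs_of_pos (hw0 r)]
        have := (hX1 r).ne'
        simp only [w]
        field_simp
      simpa [hr] using h1.le
    · simp [hr, v]
  refine ⟨_, _, hmaj, (integral_mono hmaj.integrable hdom fun r => ?_).trans hdom_le,
    (abs_integral_le_integral_abs.trans
      (integral_mono hmaj.integrable_payoff.abs hdom fun r => ?_)).trans hdom_le⟩
  · exact (le_add_of_nonneg_right (abs_nonneg _)).trans (hpt r)
  · exact (le_add_of_nonneg_left (hmaj.nonneg r)).trans (hpt r)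

lemma Majorized.exists_bump (hst : Standing μ β β' X p₀ b₀) (hp : Majorized μ β X p g)
    {B : Set Ω} (hB : MeasurableSet B) (hμB : μ B ≠ 0) {L : ℝ} (hL : 0 < L) :
    ∃ q h, Majorized μ β X q h ∧ (∀ r, p r ≤ q r) ∧ (∀ r ∉ B, q r = p r) ∧
      ∫ r, p r ∂μ + L ≤ ∫ r, q r ∂μ := by
  classical
  have := hst.sigma
  obtain ⟨n, hn⟩ : ∃ n, μ (B ∩ spanningSets μ n) ≠ 0 := by
    by_contra! h0
    refine hμB ?_
    rw [← inter_univ B, ← iUnion_spanningSets μ, inter_iUnion]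
    exact measure_iUnion_null h0
  set B₀ := B ∩ spanningSets μ n with hB₀_def
  have hB₀ : MeasurableSet B₀ := hB.inter (measurableSet_spanningSets μ n)
  have hfin : μ B₀ ≠ ⊤ :=
    ((measure_mono inter_subset_right).trans_lt (measure_spanningSets_lt_top μ n)).ne
  have hpos : 0 < (μ B₀).toReal := ENNReal.toReal_pos hn hfin
  let c : ℝ := 2 * L / (μ B₀).toReal
  have hc : 0 < c := by positivity
  obtain ⟨E, hE, hmono, hunion, hrep⟩ := hp.exists_replace hst (s := fun r => p r + c)
    (hp.meas.add_const c) fun r => add_pos_of_nonneg_of_pos (hp.nonneg r) hc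
  have hlim : Tendsto (fun k => c * (μ (B₀ ∩ E k)).toReal) atTop (𝓝 (2 * L)) := by
    have h1 : Tendsto (fun k => μ (B₀ ∩ E k)) atTop (𝓝 (μ B₀)) := by
      have := tendsto_measure_iUnion_atTop (μ := μ) (s := fun k => B₀ ∩ E k)
        fun i j hij => inter_subset_inter_right _ (hmono hij)
      rwa [← inter_iUnion, hunion, inter_univ] at this
    have h2 := ((ENNReal.tendsto_toReal hfin).comp h1).const_mul c
    rwa [show c * (μ B₀).toReal = 2 * L from div_mul_cancel₀ _ hpos.ne'] at h2
  obtain ⟨k, hk⟩ := (hlim.eventually_const_lt (show L < 2 * L by linarith)).exists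
  obtain ⟨D, hD_eq⟩ : ∃ D, D = B₀ ∩ E k := ⟨_, rfl⟩
  have hD : MeasurableSet D := hD_eq ▸ hB₀.inter (hE k)
  have hDB : D ⊆ B₀ := hD_eq ▸ inter_subset_left
  have hDE : D ⊆ E k := hD_eq ▸ inter_subset_right
  rw [← hD_eq] at hk
  have hDfin : μ D ≠ ⊤ := ((measure_mono hDB).trans_lt hfin.lt_top).ne
  refine ⟨_, _, hrep k D hD hDE, fun r => ?_, fun r hr => ?_, ?_⟩
  · by_cases hr : r ∈ D
    · rw [piecewise_eq_of_mem _ _ _ hr]; linarith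
    · rw [piecewise_eq_of_notMem _ _ _ hr]
  · rw [piecewise_eq_of_notMem _ _ _ fun h => hr (hDB h).1]
  · have h1 : D.piecewise (fun r => p r + c) p =
        fun r => p r + D.indicator (fun _ => c) r := by
      ext r
      by_cases hr : r ∈ D
      · simp only [piecewise_eq_of_mem _ _ _ hr, indicator_of_mem hr]
      · simp only [piecewise_eq_of_notMem _ _ _ hr, indicator_of_notMem hr, add_zero]
    rw [h1, integral_add hp.integrable ((integrable_indicator_iff hD).2 (integrableOn_const hDfin)),
      integral_indicator hD, setIntegral_const, smul_eq_mul, measureReal_def, mul_comm]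
    linarith

/-- Unit mass can be concentrated on the set where `σ * X` is small, keeping `H` finite. -/
lemma Standing.exists_payoff_lt (hst : Standing μ β β' X p₀ b₀) {σ v v' : ℝ} (hσ : |σ| ≤ 1)
    (hv : μ {r | σ * X r < v} ≠ 0) (hvv' : v < v') :
    ∃ p g, Majorized μ β X p g ∧ ∫ r, p r ∂μ = 1 ∧ σ * ∫ r, X r * p r ∂μ < v' := by
  have hv1 : 0 < 1 + |v| := by positivity
  set ε : ℝ := min 1 ((v' - v) / (2 * (1 + |v|))) with hε_def
  have hε : 0 < ε := lt_min one_pos (div_pos (sub_pos.2 hvv') (by positivity))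
  have hε1 : ε ≤ 1 := min_le_left _ _
  have hεv : ε * (1 + |v|) < v' - v := by
    have h1 : ε ≤ (v' - v) / (2 * (1 + |v|)) := min_le_right _ _
    rw [le_div_iff₀ (by positivity)] at h1
    linarith [mul_pos hε hv1]
  obtain ⟨p, g, hp, hp1, hpX⟩ := hst.exists_small hε
  obtain ⟨q, h, hq, hpq, hqB, hL⟩ := hp.exists_bump hst
    (measurableSet_lt (hst.Xmeas.const_mul σ) measurable_const) hv one_pos
  have hp0 : 0 ≤ ∫ r, p r ∂μ := integral_nonneg hp.nonneg
  set a := ∫ r, p r ∂μ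
  set d := ∫ r, q r ∂μ - a with hd_def
  have hd : 1 ≤ d := by linarith
  have hd0 : 0 < d := by linarith
  let t := (1 - a) / d
  have ht0 : 0 ≤ t := div_nonneg (by linarith) hd0.le
  have ht1 : t ≤ 1 := (div_le_one hd0).2 (by linarith)
  have htd : t * d = 1 - a := div_mul_cancel₀ _ hd0.ne'
  have hdiff : σ * ∫ r, X r * q r ∂μ - σ * ∫ r, X r * p r ∂μ ≤ v * d := by
    rw [hd_def, ← integral_sub hq.integrable hp.integrable, ← integral_const_mul,
      ← integral_const_mul, ← integral_const_mul, ← integral_sub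
        (hq.integrable_payoff.const_mul σ) (hp.integrable_payoff.const_mul σ)]
    refine integral_mono ((hq.integrable_payoff.const_mul σ).sub (hp.integrable_payoff.const_mul σ))
      ((hq.integrable.sub hp.integrable).const_mul v) fun r => ?_
    by_cases hr : σ * X r < v
    · have := mul_le_mul_of_nonneg_right hr.le (sub_nonneg.2 (hpq r))
      simp only
      linarith
    · simp [hqB r hr]
  refine ⟨_, _, hp.convex_comb hst hq ht0 ht1, ?_, ?_⟩
  · rw [integral_convex_comb hp.integrable hq.integrable]
    linear_combination htd
  · rw [hp.integral_payoff_convex_comb hq]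
    set xp := ∫ r, X r * p r ∂μ
    set xq := ∫ r, X r * q r ∂μ
    have h1 : σ * xp ≤ ε := (le_abs_self _).trans (by
      rw [abs_mul]; exact (mul_le_of_le_one_left (abs_nonneg _) hσ).trans hpX)
    have h2 := mul_le_mul_of_nonneg_left hdiff ht0
    have h3 : -(v * a) ≤ |v| * ε := (neg_le_abs _).trans (by
      rw [abs_mul, abs_of_nonneg hp0]; exact mul_le_mul_of_nonneg_left hp1 (abs_nonneg _))
    have h4 : σ * ((1 - t) * xp + t * xq) = σ * xp + t * (σ * xq - σ * xp) := by ring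
    have h5 : t * (v * d) = v - v * a := by linear_combination v * htd
    linarith

end Construction

section Duality

variable {Ω : Type*} [MeasurableSpace Ω] {μ : Measure Ω} {β : Ω → ℝ → EReal}
  {β' : Ω → ℝ → ℝ} {X p₀ p g : Ω → ℝ} {b₀ : ℝ}

/-- Measurable selections that increase along `F r` and dominate every positive rational. -/
lemma exists_monotone_selection {F : Ω → ℝ → ℝ}
    (hF : ∀ s : Ω → ℝ, Measurable s → (∀ r, 0 < s r) → Measurable fun r => F r (s r)) :
    ∃ s : ℕ → Ω → ℝ, (∀ n, Measurable (s n)) ∧ (∀ n r, 0 < s n r) ∧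
      (∀ r, Monotone fun n => F r (s n r)) ∧
      ∀ q : ℚ, 0 < q → ∃ n, ∀ r, F r q ≤ F r (s n r) := by
  classical
  obtain ⟨e, he⟩ := @exists_surjective_nat {q : ℚ // 0 < q} ⟨⟨1, one_pos⟩⟩ _
  have he0 : ∀ n, (0 : ℝ) < (e n).1 := fun n => by exact_mod_cast (e n).2
  let T := {s : Ω → ℝ // Measurable s ∧ ∀ r, 0 < s r}
  let step : ℕ → T → T := fun n s =>
    ⟨{r | F r (s.1 r) ≤ F r (e n).1}.piecewise (fun _ => ((e n).1 : ℝ)) s.1,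
      measurable_const.piecewise (measurableSet_le (hF _ s.2.1 s.2.2)
        (hF _ measurable_const fun _ => he0 n)) s.2.1, fun r => by
        by_cases hr : r ∈ {r | F r (s.1 r) ≤ F r (e n).1}
        · rw [piecewise_eq_of_mem _ _ _ hr]; exact he0 n
        · rw [piecewise_eq_of_notMem _ _ _ hr]; exact s.2.2 r⟩
  have hstep : ∀ n (s : T) r, F r (s.1 r) ≤ F r ((step n s).1 r) ∧
      F r (e n).1 ≤ F r ((step n s).1 r) := fun n s r => by
    by_cases hr : r ∈ {r | F r (s.1 r) ≤ F r (e n).1}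
    · simp only [step, piecewise_eq_of_mem _ _ _ hr]
      exact ⟨hr, le_rfl⟩
    · simp only [step, piecewise_eq_of_notMem _ _ _ hr]
      exact ⟨le_rfl, (not_le.1 hr).le⟩
  let s : ℕ → T := fun n => Nat.rec ⟨fun _ => 1, measurable_const, fun _ => one_pos⟩ step n
  refine ⟨fun n => (s n).1, fun n => (s n).2.1, fun n => (s n).2.2,
    fun r => monotone_nat_of_le_succ fun n => (hstep n (s n) r).1, fun q hq => ?_⟩
  obtain ⟨n, hn⟩ := he ⟨q, hq⟩
  refine ⟨n + 1, fun r => ?_⟩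
  have h1 := (hstep n (s n) r).2
  rw [hn] at h1
  exact h1

lemma Majorized.integral_lagrangian (hp : Majorized μ β X p g) (θ₁ θ₂ : ℝ) :
    Integrable (fun r => (θ₁ + θ₂ * X r) * p r - g r) μ ∧
    ∫ r, ((θ₁ + θ₂ * X r) * p r - g r) ∂μ =
      θ₁ * ∫ r, p r ∂μ + θ₂ * ∫ r, X r * p r ∂μ - ∫ r, g r ∂μ := by
  have h1 : (fun r => (θ₁ + θ₂ * X r) * p r - g r) =
      fun r => θ₁ * p r + θ₂ * (X r * p r) - g r := by
    ext r; ring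
  have h2 : Integrable (fun r => θ₁ * p r + θ₂ * (X r * p r)) μ :=
    (hp.integrable.const_mul θ₁).add (hp.integrable_payoff.const_mul θ₂)
  rw [h1]
  exact ⟨h2.sub hp.integrable_majorant, by
    rw [integral_sub h2 hp.integrable_majorant, integral_add (hp.integrable.const_mul θ₁)
      (hp.integrable_payoff.const_mul θ₂), integral_const_mul, integral_const_mul]⟩

lemma Standing.lintegral_lagrangian_sub_le (hst : Standing μ β β' X p₀ b₀) {θ₁ θ₂ c : ℝ}
    (hc : ∀ p g, Majorized μ β X p g →
      θ₁ * ∫ r, p r ∂μ + θ₂ * ∫ r, X r * p r ∂μ - ∫ r, g r ∂μ ≤ c)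
    {s : Ω → ℝ} (hs : Measurable s) (hs0 : ∀ r, 0 < s r) :
    ∫⁻ r, ENNReal.ofReal (((θ₁ + θ₂ * X r) * s r - (β r (s r)).toReal) -
        ((θ₁ + θ₂ * X r) * p₀ r - (β r (p₀ r)).toReal)) ∂μ ≤
      ENNReal.ofReal (c - ∫ r, ((θ₁ + θ₂ * X r) * p₀ r - (β r (p₀ r)).toReal) ∂μ) := by
  classical
  set φ₀ : Ω → ℝ := fun r => (θ₁ + θ₂ * X r) * p₀ r - (β r (p₀ r)).toReal with hφ₀
  set φ : Ω → ℝ := fun r => (θ₁ + θ₂ * X r) * s r - (β r (s r)).toReal with hφ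
  have hX := hst.Xmeas
  have hφ₀m : Measurable φ₀ := by
    have h1 := hst.dens₀.1
    have h2 := (hst.measurable_beta_comp h1 hst.dens₀.2.1).ereal_toReal
    fun_prop
  have hφm : Measurable φ := by
    have h2 := (hst.measurable_beta_comp hs fun r => (hs0 r).le).ereal_toReal
    fun_prop
  obtain ⟨E, hE, hmono, hunion, hrep⟩ := hst.majorized.exists_replace hst hs hs0
  have hφ₀i : Integrable φ₀ μ := (hst.majorized.integral_lagrangian θ₁ θ₂).1
  have hbound : ∀ n, ∫⁻ r, (E n).indicator (fun r => ENNReal.ofReal (φ r - φ₀ r)) r ∂μ ≤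
      ENNReal.ofReal (c - ∫ r, φ₀ r ∂μ) := fun n => by
    obtain ⟨D, hD_eq⟩ : ∃ D, D = {r | φ₀ r < φ r} ∩ E n := ⟨_, rfl⟩
    have hD : MeasurableSet D := hD_eq ▸ (measurableSet_lt hφ₀m hφm).inter (hE n)
    have hmaj := hrep n D hD (hD_eq ▸ inter_subset_right)
    obtain ⟨hi, heq⟩ := hmaj.integral_lagrangian θ₁ θ₂
    have hle := heq.trans_le (hc _ _ hmaj)
    have hfun : ∀ r, (θ₁ + θ₂ * X r) * D.piecewise s p₀ r - D.piecewise
        (fun r => (β r (s r)).toReal) (fun r => (β r (p₀ r)).toReal) r - φ₀ r =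
        D.indicator (fun r => φ r - φ₀ r) r := fun r => by
      by_cases hr : r ∈ D
      · simp only [piecewise_eq_of_mem _ _ _ hr, indicator_of_mem hr, hφ]
      · simp only [piecewise_eq_of_notMem _ _ _ hr, indicator_of_notMem hr, hφ₀, sub_self]
    have hnn : ∀ r, 0 ≤ D.indicator (fun r => φ r - φ₀ r) r :=
      indicator_nonneg fun r hr => sub_nonneg.2 <| by
        rw [hD_eq] at hr
        exact (show φ₀ r < φ r from hr.1).le
    have hint := integral_sub hi hφ₀i
    have hii := hi.sub hφ₀i
    simp only [Pi.sub_def, hfun] at hint hii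
    calc ∫⁻ r, (E n).indicator (fun r => ENNReal.ofReal (φ r - φ₀ r)) r ∂μ
        ≤ ∫⁻ r, ENNReal.ofReal (D.indicator (fun r => φ r - φ₀ r) r) ∂μ := by
          refine lintegral_mono fun r => ?_
          by_cases hr : r ∈ E n
          · rw [indicator_of_mem hr]
            by_cases hlt : φ₀ r < φ r
            · rw [indicator_of_mem (hD_eq ▸ ⟨hlt, hr⟩)]
            · rw [ENNReal.ofReal_of_nonpos (sub_nonpos.2 (not_lt.1 hlt))]
              exact zero_le
          · rw [indicator_of_notMem hr]
            exact zero_le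
      _ = ENNReal.ofReal (∫ r, D.indicator (fun r => φ r - φ₀ r) r ∂μ) :=
          (ofReal_integral_eq_lintegral_ofReal hii (ae_of_all _ hnn)).symm
      _ ≤ _ := ENNReal.ofReal_le_ofReal (by rw [hint]; exact sub_le_sub_right hle _)
  have hsup : ∀ r, ENNReal.ofReal (φ r - φ₀ r) =
      ⨆ n, (E n).indicator (fun r => ENNReal.ofReal (φ r - φ₀ r)) r := fun r => by
    refine le_antisymm ?_ (iSup_le fun n => indicator_le_self _ _ r)
    obtain ⟨n, hn⟩ := mem_iUnion.1 (hunion ▸ mem_univ r)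
    exact le_iSup_of_le n (by rw [indicator_of_mem hn])
  rw [lintegral_congr hsup, lintegral_iSup (fun n => ?_) (fun i j hij r => ?_)]
  · exact iSup_le hbound
  · exact (hφm.sub hφ₀m).ennreal_ofReal.indicator (hE n)
  · exact indicator_le_indicator_of_subset (hmono hij) (fun _ => zero_le) r

/-- Interchange of supremum and integral: a bound on the Lagrangian over all majorized pairs
bounds `K`. -/
lemma Standing.exists_Kfun_eq_le (hst : Standing μ β β' X p₀ b₀) {θ₁ θ₂ c : ℝ}
    (hc : ∀ p g, Majorized μ β X p g →
      θ₁ * ∫ r, p r ∂μ + θ₂ * ∫ r, X r * p r ∂μ - ∫ r, g r ∂μ ≤ c) :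
    ∃ κ : ℝ, Kfun μ β X θ₁ θ₂ = (κ : EReal) ∧ κ ≤ c := by
  set τ : Ω → ℝ := fun r => θ₁ + θ₂ * X r with hτ
  have hτm : Measurable τ := by have := hst.Xmeas; fun_prop
  set φ₀ : Ω → ℝ := fun r => τ r * p₀ r - (β r (p₀ r)).toReal with hφ₀
  have hφ₀i : Integrable φ₀ μ := (hst.majorized.integral_lagrangian θ₁ θ₂).1
  have hc0 : ∫ r, φ₀ r ∂μ ≤ c :=
    (hst.majorized.integral_lagrangian θ₁ θ₂).2.trans_le (hc _ _ hst.majorized)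
  have hφ₀m : Measurable φ₀ := by
    have h1 := hst.dens₀.1
    have h2 := (hst.measurable_beta_comp h1 hst.dens₀.2.1).ereal_toReal
    fun_prop
  obtain ⟨s, hs, hs0, hmono, hdom⟩ := exists_monotone_selection
    (F := fun r x => τ r * x - (β r x).toReal) fun s hs hs0 => by
      have h2 := (hst.measurable_beta_comp hs fun r => (hs0 r).le).ereal_toReal
      fun_prop
  let v : ℕ → Ω → ℝ := fun n r => τ r * s n r - (β r (s n r)).toReal
  let D : Ω → ℝ≥0∞ := fun r => ⨆ n, ENNReal.ofReal (v n r - φ₀ r)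
  have hvm : ∀ n, Measurable fun r => ENNReal.ofReal (v n r - φ₀ r) := fun n => by
    have h2 := (hst.measurable_beta_comp (hs n) fun r => (hs0 n r).le).ereal_toReal
    have h3 := hs n
    fun_prop
  have hDm : Measurable D := Measurable.iSup hvm
  have hDle : ∫⁻ r, D r ∂μ ≤ ENNReal.ofReal (c - ∫ r, φ₀ r ∂μ) := by
    rw [lintegral_iSup hvm fun i j hij r =>
      ENNReal.ofReal_le_ofReal (sub_le_sub_right (hmono r hij) _)]
    exact iSup_le fun n => hst.lintegral_lagrangian_sub_le hc (hs n) (hs0 n)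
  have hDfin : ∫⁻ r, D r ∂μ ≠ ⊤ := (hDle.trans_lt ENNReal.ofReal_lt_top).ne
  have hDi : Integrable (fun r => (D r).toReal) μ :=
    integrable_toReal_of_lintegral_ne_top hDm.aemeasurable hDfin
  have hDint : ∫ r, (D r).toReal ∂μ ≤ c - ∫ r, φ₀ r ∂μ := by
    rw [integral_toReal hDm.aemeasurable (ae_lt_top hDm hDfin)]
    exact ENNReal.toReal_le_of_le_ofReal (sub_nonneg.2 hc0) hDle
  have hreal : ∀ᵐ r ∂μ, conjβ β r (τ r) = (((conjβ β r (τ r)).toReal : ℝ) : EReal) ∧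
      φ₀ r ≤ (conjβ β r (τ r)).toReal ∧
      (conjβ β r (τ r)).toReal ≤ φ₀ r + (D r).toReal := by
    filter_upwards [ae_lt_top hDm hDfin, hst.majorized.le_majorant] with r hr hβ
    have hup : conjβ β r (τ r) ≤ ((φ₀ r + (D r).toReal : ℝ) : EReal) := by
      refine hst.conj_le r (τ r) fun q hq => ?_
      have hq' : (0 : ℝ) < q := by exact_mod_cast hq
      obtain ⟨n, hn⟩ := hdom q hq
      rw [← hst.coe_toReal_beta r hq', ← EReal.coe_sub, EReal.coe_le_coe_iff]
      have h1 : v n r - φ₀ r ≤ (D r).toReal := by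
        refine (le_max_left _ 0).trans ?_
        rw [← ENNReal.toReal_ofReal']
        exact ENNReal.toReal_mono hr.ne (le_iSup (fun n => ENNReal.ofReal (v n r - φ₀ r)) n)
      have h2 : τ r * q - (β r q).toReal ≤ v n r := hn r
      linarith
    have hlow : (φ₀ r : EReal) ≤ conjβ β r (τ r) := by
      refine le_trans ?_ (le_conjβ β r (τ r) (p₀ r))
      rw [hφ₀, EReal.coe_sub, mul_comm]
      exact EReal.sub_le_sub le_rfl hβ
    have h1 : conjβ β r (τ r) = (((conjβ β r (τ r)).toReal : ℝ) : EReal) :=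
      (EReal.coe_toReal (hup.trans_lt (EReal.coe_lt_top _)).ne
        ((EReal.bot_lt_coe _).trans_le hlow).ne').symm
    rw [h1] at hup hlow
    exact ⟨h1, EReal.coe_le_coe_iff.1 hlow, EReal.coe_le_coe_iff.1 hup⟩
  have hwi : Integrable (fun r => (conjβ β r (τ r)).toReal) μ := by
    refine integrable_of_le_of_le (hst.measurable_conj hτm).ereal_toReal.aestronglyMeasurable
      (hreal.mono fun r hr => hr.2.1) (hreal.mono fun r hr => hr.2.2) hφ₀i (hφ₀i.add hDi)
  refine ⟨_, eInt_of_integrable hwi (hreal.mono fun r hr => hr.1), ?_⟩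
  calc ∫ r, (conjβ β r (τ r)).toReal ∂μ ≤ ∫ r, (φ₀ r + (D r).toReal) ∂μ :=
        integral_mono_ae hwi (hφ₀i.add hDi) (hreal.mono fun r hr => hr.2.2)
    _ = ∫ r, φ₀ r ∂μ + ∫ r, (D r).toReal ∂μ := integral_add hφ₀i hDi
    _ ≤ c := by linarith

/-- Weak duality. -/
lemma Standing.weak_duality (hst : Standing μ β β' X p₀ b₀) {k θ₁ θ₂ : ℝ} (hθ₂ : θ₂ < 0) :
    Kfun μ β X θ₁ θ₂ = ⊤ ∨ ∃ κ : ℝ, Kfun μ β X θ₁ θ₂ = (κ : EReal) ∧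
      ∀ p, IsDensity μ p → Hfun μ β p ≤ (k : EReal) →
        (((k + κ - θ₁) / θ₂ : ℝ) : EReal) ≤ xInt μ X p := by
  have hτm : Measurable fun r => θ₁ + θ₂ * X r := by have := hst.Xmeas; fun_prop
  have hconj := hst.measurable_conj hτm
  have hφ₀i := (hst.majorized.integral_lagrangian θ₁ θ₂).1
  have hneg : ∫⁻ r, ePos (-conjβ β r (θ₁ + θ₂ * X r)) ∂μ ≠ ⊤ := by
    refine ((lintegral_mono_ae ?_).trans_lt hφ₀i.neg.lintegral_lt_top).ne
    filter_upwards [hst.majorized.le_majorant] with r hr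
    rw [← ePos_coe]
    refine ePos_mono ?_
    rw [Pi.neg_apply, EReal.coe_neg, EReal.neg_le_neg_iff]
    refine le_trans ?_ (le_conjβ β r _ (p₀ r))
    rw [EReal.coe_sub, mul_comm]
    exact EReal.sub_le_sub le_rfl hr
  by_cases hpos : ∫⁻ r, ePos (conjβ β r (θ₁ + θ₂ * X r)) ∂μ = ⊤
  · exact Or.inl (eInt_eq_top hpos hneg)
  obtain ⟨hw, hwi⟩ := integrable_toReal_of_ePos hconj hpos hneg
  set w : Ω → ℝ := fun r => (conjβ β r (θ₁ + θ₂ * X r)).toReal with hw_def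
  refine Or.inr ⟨∫ r, w r ∂μ, eInt_of_integrable hwi hw, fun p hp hH => ?_⟩
  have hHb : Hfun μ β p ≠ ⊥ := fun h => by
    have := hst.Hnonneg p hp
    simp [h] at this
  obtain ⟨hβ, hβi⟩ := integrable_toReal_of_eInt (hst.measurable_beta_comp hp.1 hp.2.1) hHb
    (hH.trans_lt (EReal.coe_lt_top k)).ne
  have hHk : ∫ r, (β r (p r)).toReal ∂μ ≤ k := by
    rw [Hfun, eInt_of_integrable hβi hβ] at hH
    exact EReal.coe_le_coe_iff.1 hH
  have hRi : Integrable (fun r => (w r + (β r (p r)).toReal - θ₁ * p r) / θ₂) μ :=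
    ((hwi.add hβi).sub (hp.integrable.const_mul θ₁)).div_const θ₂
  have hRint : ∫ r, (w r + (β r (p r)).toReal - θ₁ * p r) / θ₂ ∂μ =
      (∫ r, w r ∂μ + ∫ r, (β r (p r)).toReal ∂μ - θ₁) / θ₂ := by
    have h1 : Integrable (fun r => w r + (β r (p r)).toReal) μ := hwi.add hβi
    rw [integral_div, integral_sub h1 (hp.integrable.const_mul θ₁),
      integral_add hwi hβi, integral_const_mul, hp.integral_eq_one, mul_one]
  have hle : ∀ᵐ r ∂μ, (w r + (β r (p r)).toReal - θ₁ * p r) / θ₂ ≤ X r * p r := by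
    filter_upwards [hw, hβ] with r hwr hβr
    have h1 := le_conjβ β r (θ₁ + θ₂ * X r) (p r)
    rw [hwr, hβr, ← EReal.coe_sub, EReal.coe_le_coe_iff] at h1
    rw [div_le_iff_of_neg hθ₂]
    simp only [hw_def]
    linarith
  have hXneg : ∫⁻ r, ePos (-((X r * p r : ℝ) : EReal)) ∂μ ≠ ⊤ := by
    refine ((lintegral_mono_ae (hle.mono fun r hr => ?_)).trans_lt hRi.neg.lintegral_lt_top).ne
    rw [← EReal.coe_neg, ePos_coe]
    exact ENNReal.ofReal_le_ofReal (neg_le_neg hr)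
  by_cases hXpos : ∫⁻ r, ePos ((X r * p r : ℝ) : EReal) ∂μ = ⊤
  · rw [xInt, eInt_eq_top hXpos hXneg]
    exact le_top
  have hXi : Integrable (fun r => X r * p r) μ := by
    simpa only [EReal.toReal_coe, Pi.mul_apply] using
      (integrable_toReal_of_ePos (hst.Xmeas.mul hp.1).coe_real_ereal hXpos hXneg).2
  rw [xInt_of_integrable hXi, EReal.coe_le_coe_iff]
  refine le_trans ?_ (hRint.symm.trans_le (integral_mono_ae hRi hXi hle))
  rw [div_le_div_right_of_neg hθ₂]
  linarith

end Duality

/-- A convex set in finite dimension that lies in no hyperplane is supported at every point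
outside its interior. -/
lemma exists_supporting_of_convex {E : Type*} [NormedAddCommGroup E] [NormedSpace ℝ E]
    [FiniteDimensional ℝ E] {C : Set E} {x : E} (hC : Convex ℝ C) (hne : C.Nonempty)
    (hspan : ∀ f : E →ₗ[ℝ] ℝ, (∀ y ∈ C, ∀ z ∈ C, f y = f z) → f = 0) (hx : x ∉ interior C) :
    ∃ f : E →ₗ[ℝ] ℝ, f ≠ 0 ∧ ∀ y ∈ C, f x ≤ f y := by
  have hint : (interior C).Nonempty := by
    rw [hC.interior_nonempty_iff_affineSpan_eq_top,
      AffineSubspace.affineSpan_eq_top_iff_vectorSpan_eq_top_of_nonempty ℝ E E hne]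
    by_contra hlt
    obtain ⟨f, hf0, hf⟩ := Submodule.exists_le_ker_of_lt_top _ (lt_top_iff_ne_top.2 hlt)
    refine hf0 (hspan f fun y hy z hz => sub_eq_zero.1 ?_)
    rw [← map_sub]
    exact hf (vsub_mem_vectorSpan ℝ hy hz)
  obtain ⟨f, hf⟩ := geometric_hahn_banach_point_open hC.interior isOpen_interior hx
  refine ⟨f, fun h0 => ?_, fun y hy => ?_⟩
  · obtain ⟨y, hy⟩ := hint
    have h1 : ∀ z, f z = 0 := fun z => DFunLike.congr_fun h0 z
    have := hf y hy
    simp [h1] at this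
  · have hy' : y ∈ closure (interior C) := by
      rw [hC.closure_interior_eq_closure_of_nonempty_interior hint]
      exact subset_closure hy
    exact closure_minimal (fun z hz => (hf z hz).le)
      (isClosed_le continuous_const f.continuous) hy'

section Attainment

variable {Ω : Type*} [MeasurableSpace Ω] {μ : Measure Ω} {β : Ω → ℝ → EReal}
  {β' : Ω → ℝ → ℝ} {X p₀ p g : Ω → ℝ} {b₀ : ℝ}

lemma Standing.exists_payoff_lt_of_essInf_lt (hst : Standing μ β β' X p₀ b₀) {v : ℝ}
    (hv : essInfX μ X < (v : EReal)) :
    ∃ p g, Majorized μ β X p g ∧ ∫ r, p r ∂μ = 1 ∧ ∫ r, X r * p r ∂μ < v := by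
  obtain ⟨w, hw, hwv⟩ := EReal.lt_iff_exists_real_btwn.1 hv
  have hpos : μ {r | 1 * X r < w} ≠ 0 := fun h0 => hw.not_ge <| le_essInf_of_ae_le _ <| by
    filter_upwards [measure_eq_zero_iff_ae_notMem.1 h0] with r hr
    exact EReal.coe_le_coe_iff.2 (by simpa using hr)
  obtain ⟨p, g, hp, h1, h2⟩ :=
    hst.exists_payoff_lt (by simp) hpos (EReal.coe_lt_coe_iff.1 hwv)
  exact ⟨p, g, hp, h1, by simpa using h2⟩

lemma Standing.exists_lt_payoff_of_lt_essSup (hst : Standing μ β β' X p₀ b₀) {v : ℝ}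
    (hv : (v : EReal) < essSupX μ X) :
    ∃ p g, Majorized μ β X p g ∧ ∫ r, p r ∂μ = 1 ∧ v < ∫ r, X r * p r ∂μ := by
  obtain ⟨w, hvw, hw⟩ := EReal.lt_iff_exists_real_btwn.1 hv
  have hpos : μ {r | -1 * X r < -w} ≠ 0 := fun h0 => hw.not_ge <| essSup_le_of_ae_le _ <| by
    filter_upwards [measure_eq_zero_iff_ae_notMem.1 h0] with r hr
    exact EReal.coe_le_coe_iff.2 (by simpa using hr)
  obtain ⟨p, g, hp, h1, h2⟩ :=
    hst.exists_payoff_lt (by simp) hpos (neg_lt_neg (EReal.coe_lt_coe_iff.1 hvw))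
  exact ⟨p, g, hp, h1, by linarith⟩

/-- Mass, payoff and divergence bound of the majorized pairs. -/
def attainable (μ : Measure Ω) (β : Ω → ℝ → EReal) (X : Ω → ℝ) : Set (ℝ × ℝ × ℝ) :=
  {x | ∃ p g, Majorized μ β X p g ∧ ∫ r, p r ∂μ = x.1 ∧ ∫ r, X r * p r ∂μ = x.2.1 ∧
    ∫ r, g r ∂μ = x.2.2}

lemma Majorized.mem_attainable (hp : Majorized μ β X p g) :
    (∫ r, p r ∂μ, ∫ r, X r * p r ∂μ, ∫ r, g r ∂μ) ∈ attainable μ β X :=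
  ⟨p, g, hp, rfl, rfl, rfl⟩

lemma Standing.convex_attainable (hst : Standing μ β β' X p₀ b₀) :
    Convex ℝ (attainable μ β X) := by
  rintro ⟨a, b, h⟩ ⟨p, g, hp, ha, hb, hh⟩ ⟨a', b', h'⟩ ⟨p', g', hp', ha', hb', hh'⟩ s t hs ht hst1
  obtain rfl : s = 1 - t := by linarith
  refine ⟨_, _, hp.convex_comb hst hp' ht (by linarith), ?_, ?_, ?_⟩
  · rw [integral_convex_comb hp.integrable hp'.integrable, ha, ha']; rfl
  · rw [hp.integral_payoff_convex_comb hp', hb, hb']; rfl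
  · rw [integral_convex_comb hp.integrable_majorant hp'.integrable_majorant, hh, hh']; rfl

lemma Standing.attainable_mono (hst : Standing μ β β' X p₀ b₀) {a b h h' : ℝ}
    (hx : (a, b, h) ∈ attainable μ β X) (hh : h ≤ h') : (a, b, h') ∈ attainable μ β X := by
  obtain ⟨p, g, hp, ha, hb, hg⟩ := hx
  have hi := hst.dens₀.integrable.const_mul (h' - h)
  refine ⟨p, _, hp.add_majorant hi fun r => mul_nonneg (sub_nonneg.2 hh) (hst.dens₀.2.1 r),
    ha, hb, ?_⟩
  rw [integral_add hp.integrable_majorant hi, integral_const_mul, hst.dens₀.integral_eq_one, hg]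
  simp

lemma Standing.mem_attainable (hst : Standing μ β β' X p₀ b₀) :
    ((1 : ℝ), b₀, (0 : ℝ)) ∈ attainable μ β X :=
  ⟨_, _, hst.majorized, hst.dens₀.integral_eq_one, hst.integral_payoff, hst.integral_beta⟩

lemma Standing.exists_one_lt_mass (hst : Standing μ β β' X p₀ b₀) :
    ∃ a b h : ℝ, 1 < a ∧ (a, b, h) ∈ attainable μ β X := by
  have hne : μ univ ≠ 0 := fun h0 => by
    have h1 := hst.dens₀.2.2
    rw [Measure.measure_univ_eq_zero.1 h0, lintegral_zero_measure] at h1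
    exact zero_ne_one h1
  obtain ⟨q, h, hq, -, -, hle⟩ := hst.majorized.exists_bump hst MeasurableSet.univ hne one_pos
  rw [hst.dens₀.integral_eq_one] at hle
  exact ⟨_, _, _, by linarith, hq.mem_attainable⟩

lemma Standing.exists_mass_lt_one (hst : Standing μ β β' X p₀ b₀) :
    ∃ a b h : ℝ, a < 1 ∧ (a, b, h) ∈ attainable μ β X := by
  obtain ⟨p, g, hp, h1, -⟩ := hst.exists_small (ε := 1 / 2) (by norm_num)
  exact ⟨_, _, _, by linarith, hp.mem_attainable⟩

lemma linearMap_prod_apply (f : ℝ × ℝ × ℝ →ₗ[ℝ] ℝ) (a b h : ℝ) :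
    f (a, b, h) = f (1, 0, 0) * a + f (0, 1, 0) * b + f (0, 0, 1) * h := by
  have : ((a, b, h) : ℝ × ℝ × ℝ) = a • (1, 0, 0) + b • (0, 1, 0) + h • (0, 0, 1) := by simp
  rw [this, map_add, map_add, map_smul, map_smul, map_smul]
  simp only [smul_eq_mul]
  ring

lemma Standing.eq_zero_of_const_attainable (hst : Standing μ β β' X p₀ b₀)
    (f : ℝ × ℝ × ℝ →ₗ[ℝ] ℝ)
    (hf : ∀ y ∈ attainable μ β X, ∀ z ∈ attainable μ β X, f y = f z) : f = 0 := by
  obtain ⟨p, g, hp, hp1, hpb⟩ := hst.exists_lt_payoff_of_lt_essSup hst.ltM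
  obtain ⟨a, b, h, ha, hmem⟩ := hst.exists_mass_lt_one
  have h0 := hst.mem_attainable
  have e1 := hf _ (hst.attainable_mono h0 zero_le_one) _ h0
  have e2 := hf _ hp.mem_attainable _ h0
  have e3 := hf _ hmem _ h0
  rw [linearMap_prod_apply f, linearMap_prod_apply f 1 b₀ 0] at e1 e2 e3
  have hη : f (0, 0, 1) = 0 := by linarith
  rw [hη, hp1] at e2
  have hγ : f (0, 1, 0) = 0 := by
    have : f (0, 1, 0) * (∫ r, X r * p r ∂μ - b₀) = 0 := by linarith
    exact (mul_eq_zero.1 this).resolve_right (by linarith)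
  rw [hη, hγ] at e3
  have hα : f (1, 0, 0) = 0 := by
    have : f (1, 0, 0) * (a - 1) = 0 := by linarith
    exact (mul_eq_zero.1 this).resolve_right (by linarith)
  refine LinearMap.ext fun ⟨a, b, h⟩ => ?_
  rw [linearMap_prod_apply f, hη, hγ, hα]
  simp

lemma Standing.exists_le_payoff (hst : Standing μ β β' X p₀ b₀) {k : ℝ} (hk0 : 0 < k)
    (hk : (k : EReal) < kmax μ β X b₀) :
    ∃ b₁ : ℝ, essInfX μ X < (b₁ : EReal) ∧
      ∀ b, ((1 : ℝ), b, k) ∈ attainable μ β X → b₁ ≤ b := by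
  obtain ⟨⟨b₁, hb₁, hb₁0⟩, hF⟩ := lt_iSup_iff.1 hk
  refine ⟨b₁, hb₁, fun b hb => ?_⟩
  by_contra! hlt
  have h0 := hst.attainable_mono hst.mem_attainable hk0.le
  set t := (b₁ - b) / (b₀ - b) with ht
  have hd : 0 < b₀ - b := by linarith
  have ht0 : 0 ≤ t := div_nonneg (by linarith) hd.le
  have ht1 : t ≤ 1 := (div_le_one hd).2 (by linarith)
  have htb : t * (b₀ - b) = b₁ - b := div_mul_cancel₀ _ hd.ne'
  obtain ⟨p, g, hp, hp1, hpb, hg⟩ :=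
    hst.convex_attainable hb h0 (sub_nonneg.2 ht1) ht0 (by ring)
  have hp1' : ∫ r, p r ∂μ = 1 := by rw [hp1]; simp
  have hpb' : ∫ r, X r * p r ∂μ = b₁ := by rw [hpb]; simp; linarith
  have hg' : ∫ r, g r ∂μ = k := by rw [hg]; simp; ring
  refine hF.not_ge ((iInf_le _ ⟨p, hp.isDensity hp1', ?_⟩).trans (hg' ▸ hp.Hfun_le))
  rw [xInt_of_integrable hp.integrable_payoff, hpb']

lemma Vfun_le_of_mem_attainable {k b : ℝ}
    (hb : ((1 : ℝ), b, k) ∈ attainable μ β X) : Vfun μ β X k ≤ (b : EReal) := by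
  obtain ⟨p, g, hp, hp1, hpb, hg⟩ := hb
  refine (iInf_le _ ⟨p, hp.isDensity hp1, hp.Hfun_le.trans_eq (by rw [hg])⟩).trans_eq ?_
  rw [xInt_of_integrable hp.integrable_payoff, hpb]

/-- Supporting multipliers at the optimal point. -/
lemma Standing.exists_multipliers (hst : Standing μ β β' X p₀ b₀) {k b₁ : ℝ} (hk0 : 0 < k)
    (hb₁ : essInfX μ X < (b₁ : EReal))
    (hle : ∀ b, ((1 : ℝ), b, k) ∈ attainable μ β X → b₁ ≤ b) :
    ∃ v θ₁ θ₂ : ℝ, θ₂ < 0 ∧ Vfun μ β X k ≤ (v : EReal) ∧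
      ∀ p g, Majorized μ β X p g →
        θ₁ * ∫ r, p r ∂μ + θ₂ * ∫ r, X r * p r ∂μ - ∫ r, g r ∂μ ≤ θ₁ + θ₂ * v - k := by
  set B : Set ℝ := {b | ((1 : ℝ), b, k) ∈ attainable μ β X} with hB
  have hB₀ : b₀ ∈ B := hst.attainable_mono hst.mem_attainable hk0.le
  have hbdd : BddBelow B := ⟨b₁, hle⟩
  set v := sInf B with hv
  have hb₁v : b₁ ≤ v := le_csInf ⟨b₀, hB₀⟩ hle
  have hvb₀ : v ≤ b₀ := csInf_le hbdd hB₀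
  have hnot : ((1 : ℝ), v, k) ∉ interior (attainable μ β X) := fun hint => by
    have hcont : Tendsto (fun b : ℝ => ((1 : ℝ), b, k)) (𝓝[<] v) (𝓝 ((1 : ℝ), v, k)) :=
      (Continuous.tendsto (by fun_prop) v).mono_left nhdsWithin_le_nhds
    obtain ⟨b, hb, hbv⟩ := ((hcont.eventually (mem_interior_iff_mem_nhds.1 hint)).and
      self_mem_nhdsWithin).exists
    exact (csInf_le hbdd (show b ∈ B from hb)).not_gt hbv
  obtain ⟨f, hf0, hf⟩ := exists_supporting_of_convex hst.convex_attainable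
    ⟨_, hst.mem_attainable⟩ hst.eq_zero_of_const_attainable hnot
  set α := f (1, 0, 0) with hα
  set γ := f (0, 1, 0) with hγ
  set η := f (0, 0, 1) with hη
  have hsep : ∀ a b h, (a, b, h) ∈ attainable μ β X →
      0 ≤ α * (a - 1) + γ * (b - v) + η * (h - k) := fun a b h hm => by
    have := hf _ hm
    rw [linearMap_prod_apply f, linearMap_prod_apply f a b h] at this
    linarith
  have hη0 : 0 ≤ η := by
    by_contra! hneg
    obtain ⟨N, hN0, hN⟩ : ∃ N : ℝ, 0 ≤ N ∧ k + (γ * (b₀ - v) + 1) / -η ≤ N :=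
      ⟨max 0 _, le_max_left _ _, le_max_right _ _⟩
    have h1 := hsep _ _ _ (hst.attainable_mono hst.mem_attainable hN0)
    have h2 : (γ * (b₀ - v) + 1) / -η ≤ N - k := by linarith
    rw [div_le_iff₀ (neg_pos.2 hneg)] at h2
    linarith
  have hηpos : 0 < η := by
    refine hη0.lt_of_ne' fun h0 => hf0 ?_
    obtain ⟨p, g, hp, hp1, hpb⟩ := hst.exists_lt_payoff_of_lt_essSup hst.ltM
    obtain ⟨p', g', hp', hp1', hpb'⟩ := hst.exists_payoff_lt_of_essInf_lt hb₁
    have e1 := hsep _ _ _ hp.mem_attainable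
    have e2 := hsep _ _ _ hp'.mem_attainable
    rw [hp1, h0] at e1
    rw [hp1', h0] at e2
    have hγ0 : γ = 0 := by
      refine le_antisymm (not_lt.1 fun h => ?_) (not_lt.1 fun h => ?_)
      · have := mul_neg_of_pos_of_neg h (sub_neg.2 (hpb'.trans_le hb₁v))
        linarith
      · have := mul_neg_of_neg_of_pos h (sub_pos.2 (hvb₀.trans_lt hpb))
        linarith
    obtain ⟨a, b, h, ha, hm⟩ := hst.exists_mass_lt_one
    obtain ⟨a', b', h', ha', hm'⟩ := hst.exists_one_lt_mass
    have e3 := hsep _ _ _ hm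
    have e4 := hsep _ _ _ hm'
    rw [h0, hγ0] at e3 e4
    have hα0 : α = 0 := by
      refine le_antisymm (not_lt.1 fun h => ?_) (not_lt.1 fun h => ?_)
      · have := mul_neg_of_pos_of_neg h (sub_neg.2 ha)
        linarith
      · have := mul_neg_of_neg_of_pos h (sub_pos.2 ha')
        linarith
    refine LinearMap.ext fun ⟨a, b, h⟩ => ?_
    rw [linearMap_prod_apply f, ← hα, ← hγ, ← hη, h0, hγ0, hα0]
    simp
  have hγpos : 0 < γ := by
    have h1 := hsep _ _ _ hst.mem_attainable
    have h2 := mul_pos hηpos hk0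
    exact pos_of_mul_pos_left (by linarith : 0 < γ * (b₀ - v)) (sub_nonneg.2 hvb₀)
  refine ⟨v, -α / η, -γ / η, div_neg_of_neg_of_pos (neg_neg_of_pos hγpos) hηpos, ?_,
    fun p g hp => ?_⟩
  · refine EReal.le_of_forall_lt_iff_le.1 fun w hw => ?_
    obtain ⟨b, hb, hbw⟩ := exists_lt_of_csInf_lt ⟨b₀, hB₀⟩ (EReal.coe_lt_coe_iff.1 hw)
    exact (Vfun_le_of_mem_attainable hb).trans (EReal.coe_le_coe_iff.2 hbw.le)
  · have h1 := hsep _ _ _ hp.mem_attainable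
    have h2 : -α / η + -γ / η * v - k - (-α / η * ∫ r, p r ∂μ + -γ / η * ∫ r, X r * p r ∂μ -
        ∫ r, g r ∂μ) = (α * (∫ r, p r ∂μ - 1) + γ * (∫ r, X r * p r ∂μ - v) +
          η * (∫ r, g r ∂μ - k)) / η := by
      field_simp
      ring
    have h3 := div_nonneg h1 hηpos.le
    rw [← h2] at h3
    linarith

/-- The divergence-constrained value is attained in the dual problem. -/
lemma Standing.exists_dual_optimum (hst : Standing μ β β' X p₀ b₀) {k : ℝ} (hk0 : 0 < k)
    (hk : (k : EReal) < kmax μ β X b₀) :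
    ∃ θ₁ θ₂ κ : ℝ, θ₂ < 0 ∧ Kfun μ β X θ₁ θ₂ = (κ : EReal) ∧
      Vfun μ β X k = (((k + κ - θ₁) / θ₂ : ℝ) : EReal) := by
  obtain ⟨b₁, hb₁, hle⟩ := hst.exists_le_payoff hk0 hk
  obtain ⟨v, θ₁, θ₂, hθ₂, hV, hc⟩ := hst.exists_multipliers hk0 hb₁ hle
  obtain ⟨κ, hκ, hκc⟩ := hst.exists_Kfun_eq_le hc
  refine ⟨θ₁, θ₂, κ, hθ₂, hκ, le_antisymm (hV.trans (EReal.coe_le_coe_iff.2 ?_)) ?_⟩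
  · rw [le_div_iff_of_neg hθ₂]
    linarith
  · rcases hst.weak_duality (k := k) (θ₁ := θ₁) hθ₂ with htop | ⟨κ', hκ', hle'⟩
    · exact absurd (hκ.symm.trans htop) (EReal.coe_ne_top κ)
    · obtain rfl : κ = κ' := EReal.coe_injective (hκ.symm.trans hκ')
      exact le_iInf fun p => hle' p.1 p.2.1 p.2.2

lemma Standing.le_Kfun_sub (hst : Standing μ β β' X p₀ b₀) {k d θ₁ θ₂ : ℝ} (hθ₂ : θ₂ < 0)
    (hV : Vfun μ β X k = (d : EReal)) :
    ((θ₂ * d - k : ℝ) : EReal) ≤ Kfun μ β X θ₁ θ₂ - (θ₁ : EReal) := by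
  rcases hst.weak_duality (k := k) (θ₁ := θ₁) hθ₂ with htop | ⟨κ, hκ, hle⟩
  · rw [htop, EReal.top_sub_coe]
    exact le_top
  · have h1 : (((k + κ - θ₁) / θ₂ : ℝ) : EReal) ≤ Vfun μ β X k :=
      le_iInf fun p => hle p.1 p.2.1 p.2.2
    rw [hV, EReal.coe_le_coe_iff, div_le_iff_of_neg hθ₂] at h1
    rw [hκ, ← EReal.coe_sub, EReal.coe_le_coe_iff]
    linarith

end Attainment

lemma add_div_le_of_le {y : EReal} {k c d : ℝ} (hc : c < 0)
    (h : ((c * d - k : ℝ) : EReal) ≤ y) : ((k : EReal) + y) / (c : EReal) ≤ (d : EReal) := by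
  induction y with
  | bot => exact absurd (le_bot_iff.1 h) (EReal.coe_ne_bot _)
  | top =>
    rw [EReal.coe_add_top, EReal.top_div_of_neg_ne_bot (by exact_mod_cast hc) (EReal.coe_ne_bot c)]
    exact bot_le
  | coe y =>
    rw [← EReal.coe_add, ← EReal.coe_div, EReal.coe_le_coe_iff, div_le_iff_of_neg hc]
    linarith [EReal.coe_le_coe_iff.1 h]

/-- Theorem 1 of the paper. For every `k ∈ (0, k_max)`,
`V(k) = max_{θ₂<0} max_{θ₁} (k + K(θ₁,θ₂) − θ₁)/θ₂ = max_{θ₂<0} (k + G(θ₂))/θ₂`,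
both maxima being attained. -/
theorem Vk_double_max {Ω : Type*} [MeasurableSpace Ω] (μ : Measure Ω)
    (β : Ω → ℝ → EReal) (β' : Ω → ℝ → ℝ) (X : Ω → ℝ) (p₀ : Ω → ℝ) (b₀ : ℝ)
    (hst : Standing μ β β' X p₀ b₀)
    (k : ℝ) (hk0 : 0 < k) (hkmax : (k : EReal) < kmax μ β X b₀) :
    ∃ θ₁ θ₂ : ℝ, θ₂ < 0 ∧
      Vfun μ β X k =
        ((k : EReal) + Kfun μ β X θ₁ θ₂ - (θ₁ : EReal)) / ((θ₂ : ℝ) : EReal) ∧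
      (∀ θ₁' θ₂' : ℝ, θ₂' < 0 →
        ((k : EReal) + Kfun μ β X θ₁' θ₂' - (θ₁' : EReal)) / ((θ₂' : ℝ) : EReal) ≤
          Vfun μ β X k) ∧
      Vfun μ β X k = ((k : EReal) + Gfun μ β X θ₂) / ((θ₂ : ℝ) : EReal) ∧
      (∀ θ₂' : ℝ, θ₂' < 0 →
        ((k : EReal) + Gfun μ β X θ₂') / ((θ₂' : ℝ) : EReal) ≤ Vfun μ β X k) := by
  obtain ⟨θ₁, θ₂, κ, hθ₂, hκ, hV⟩ := hst.exists_dual_optimum hk0 hkmax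
  set d := (k + κ - θ₁) / θ₂ with hd
  have hG : Gfun μ β X θ₂ = ((κ - θ₁ : ℝ) : EReal) := by
    refine le_antisymm ((iInf_le _ θ₁).trans_eq (by rw [hκ, EReal.coe_sub]))
      (le_iInf fun θ₁' => ?_)
    have h1 : κ - θ₁ = θ₂ * d - k := by rw [hd, mul_div_cancel₀ _ hθ₂.ne]; ring
    exact h1 ▸ hst.le_Kfun_sub hθ₂ hV
  refine ⟨θ₁, θ₂, hθ₂, ?_, fun θ₁' θ₂' hθ₂' => ?_, ?_, fun θ₂' hθ₂' => ?_⟩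
  · rw [hV, hκ, ← EReal.coe_add, ← EReal.coe_sub, ← EReal.coe_div]
  · rw [hV, sub_eq_add_neg, add_assoc, ← sub_eq_add_neg]
    exact add_div_le_of_le hθ₂' (hst.le_Kfun_sub hθ₂' hV)
  · rw [hV, hG, ← EReal.coe_add, ← EReal.coe_div, hd, add_sub_assoc]
  · rw [hV]
    exact add_div_le_of_le hθ₂' (le_iInf fun θ₁' => hst.le_Kfun_sub hθ₂' hV)
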